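/- arXiv:1411.7617 — 3 statements merged into one kernel-verified Lean document; each statement's English description precedes it below -/
import Mathlib

section
/- For each λ > 0, the operator B_λ : H¹(Ω) → H¹(Ω)' is maximal monotone; equivalently, Rg(R + B_λ) = H¹(Ω)' where R is the Riesz isomorphism of H¹(Ω): for every F ∈ H¹(Ω)' there exists u ∈ H¹(Ω) such that (1+λ)∫_Ω uz dx + 2∫_Ω ∇u·∇z dx + ∫_{Γ₁} β_λ(u)z ds = ⟨F,z⟩ for all z ∈ H¹(Ω). -/
open Set MeasureTheory
open scoped ENNReal

noncomputable section

/-- A set-valued operator on `ℝ` is maximal monotone. -/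
def MaxMonotone (A : ℝ → Set ℝ) : Prop :=
  (∀ ⦃x₁ y₁ x₂ y₂ : ℝ⦄, y₁ ∈ A x₁ → y₂ ∈ A x₂ → 0 ≤ (y₁ - y₂) * (x₁ - x₂)) ∧
  (∀ x y : ℝ, (∀ x' y', y' ∈ A x' → 0 ≤ (y - y') * (x - x')) → y ∈ A x)

/-- The pairing `⟨B_λ(u), z⟩ = λ∫_Ω u z dx + ∫_Ω ∇u·∇z dx + ∫_{Γ₁} β_λ(u) z ds` in the
abstract setting (`ι` = inclusion `H¹(Ω) ⊆ L²(Ω)`, `τ` = trace on `Γ₁`, `a` = Dirichlet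
form, `βlam` = Yosida approximation of `β`). -/
def Bpair {X Y : Type*} [MeasurableSpace X] [MeasurableSpace Y]
    {μ : Measure X} {ν : Measure Y}
    {V : Type*} [NormedAddCommGroup V] [InnerProductSpace ℝ V] [CompleteSpace V]
    (ι : V →L[ℝ] Lp ℝ 2 μ) (τ : V →L[ℝ] Lp ℝ 2 ν)
    (a : V →L[ℝ] V →L[ℝ] ℝ) (lam : ℝ) (βlam : ℝ → ℝ) (u z : V) : ℝ :=
  lam * (∫ x, (ι u) x * (ι z) x ∂μ) + a u z + ∫ y, βlam ((τ u) y) * (τ z) y ∂ν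

theorem aux_zarantonello {V : Type*} [NormedAddCommGroup V] [InnerProductSpace ℝ V]
    [CompleteSpace V] (A : V → V) (L : ℝ)
    (hmono : ∀ u v, ‖u - v‖ ^ 2 ≤ inner ℝ (A u - A v) (u - v))
    (hlip : ∀ u v, ‖A u - A v‖ ≤ L * ‖u - v‖) (f : V) : ∃ u, A u = f := by
  obtain ⟨M, hM1, hM⟩ : ∃ M : ℝ, 1 ≤ M ∧ ∀ u v, ‖A u - A v‖ ≤ M * ‖u - v‖ :=
    ⟨max 1 L, le_max_left _ _, fun u v => (hlip u v).trans
      (mul_le_mul_of_nonneg_right (le_max_right _ _) (norm_nonneg _))⟩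
  set t : ℝ := 1 / M ^ 2 with ht
  have hM2 : 0 < M ^ 2 := by positivity
  have ht0 : 0 < t := by positivity
  have htM : t * M ^ 2 = 1 := by rw [ht]; field_simp
  have ht1 : t ≤ 1 := by rw [ht, div_le_one hM2]; nlinarith
  set S : V → V := fun u => u - t • (A u - f) with hS
  have hK : ContractingWith (Real.toNNReal (Real.sqrt (1 - t))) S := by
    constructor
    · rw [← Real.toNNReal_one, Real.toNNReal_lt_toNNReal_iff one_pos]
      rw [Real.sqrt_lt' one_pos]; linarith
    · apply LipschitzWith.of_dist_le_mul
      intro u v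
      rw [Real.coe_toNNReal _ (Real.sqrt_nonneg _), dist_eq_norm, dist_eq_norm]
      refine abs_le_of_sq_le_sq' ?_ (by positivity) |>.2
      rw [mul_pow, Real.sq_sqrt (by linarith)]
      have e : S u - S v = (u - v) - t • (A u - A v) := by
        simp only [hS, smul_sub]; abel
      rw [e, norm_sub_sq_real, inner_smul_right, norm_smul, real_inner_comm, mul_pow,
        Real.norm_eq_abs, sq_abs]
      have h1 := hmono u v
      have h2 : ‖A u - A v‖ ^ 2 ≤ M ^ 2 * ‖u - v‖ ^ 2 := by
        rw [← mul_pow]; exact pow_le_pow_left₀ (norm_nonneg _) (hM u v) 2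
      have h3 : t ^ 2 * ‖A u - A v‖ ^ 2 ≤ t * ‖u - v‖ ^ 2 := by
        calc _ ≤ t ^ 2 * (M ^ 2 * ‖u - v‖ ^ 2) := by gcongr
          _ = t * (t * M ^ 2) * ‖u - v‖ ^ 2 := by ring
          _ = _ := by rw [htM, mul_one]
      nlinarith [mul_le_mul_of_nonneg_left h1 ht0.le]
  refine ⟨hK.fixedPoint S, ?_⟩
  have h := hK.fixedPoint_isFixedPt
  have h' : t • (A (hK.fixedPoint S) - f) = 0 := sub_eq_self.1 h
  rcases smul_eq_zero.1 h' with h | h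
  · exact absurd h ht0.ne'
  · exact sub_eq_zero.1 h

theorem aux_yosida (β : ℝ → Set ℝ) (hβ : MaxMonotone β)
    (lam : ℝ) (βlam : ℝ → ℝ) (hYos : ∀ r : ℝ, βlam r ∈ β (r - lam * βlam r)) (r s : ℝ) :
    lam * (βlam r - βlam s) ^ 2 ≤ (βlam r - βlam s) * (r - s) := by
  have := hβ.1 (hYos r) (hYos s)
  nlinarith

theorem aux_inner {Y : Type*} [MeasurableSpace Y] {ν : Measure Y} (f g : Lp ℝ 2 ν) :
    inner ℝ f g = ∫ y, f y * g y ∂ν := by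
  rw [L2.inner_def]
  congr 1; ext y; simp [mul_comm]

theorem aux_mono {Y : Type*} [MeasurableSpace Y] {ν : Measure Y} {b : ℝ → ℝ} {K : NNReal}
    (hb : LipschitzWith K b) (h0 : b 0 = 0) (hm : ∀ r s, 0 ≤ (b r - b s) * (r - s))
    (f g : Lp ℝ 2 ν) : 0 ≤ inner ℝ (hb.compLp h0 f - hb.compLp h0 g) (f - g) := by
  rw [aux_inner]
  apply integral_nonneg_of_ae
  filter_upwards [Lp.coeFn_sub f g, Lp.coeFn_sub (hb.compLp h0 f) (hb.compLp h0 g),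
    hb.coeFn_compLp h0 f, hb.coeFn_compLp h0 g] with y h1 h2 h3 h4
  simp only [h1, h2, Pi.sub_apply, h3, h4, Function.comp_apply, Pi.zero_apply]
  exact hm _ _

/-- For each `λ > 0` the operator `B_λ : H¹(Ω) → H¹(Ω)'` is maximal
monotone; equivalently (`B_λ` being monotone) `Rg(R + B_λ) = H¹(Ω)'`, where `R` is the
Riesz isomorphism of `H¹(Ω)`: for every `F ∈ H¹(Ω)'` there exists `u ∈ H¹(Ω)` with
`(1+λ)∫_Ω u z dx + 2∫_Ω ∇u·∇z dx + ∫_{Γ₁} β_λ(u) z ds = ⟨F,z⟩` for all `z ∈ H¹(Ω)`.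
(The Riesz pairing of `H¹(Ω)` is `⟨Ru,z⟩ = ∫_Ω u z + ∫_Ω ∇u·∇z`, since
`‖u‖²_{H¹} = ‖u‖²_{L²} + ‖∇u‖²_{L²}`; compactness of the trace `τ` encodes the compactness
of the embedding `H¹(Ω) ↪ H^{1-δ}(Ω)` together with trace continuity used in the proof.) -/
theorem stmt_8
    {X Y : Type*} [MeasurableSpace X] [MeasurableSpace Y]
    (μ : Measure X) (ν : Measure Y) [IsFiniteMeasure μ] [IsFiniteMeasure ν]
    {V : Type*} [NormedAddCommGroup V] [InnerProductSpace ℝ V] [CompleteSpace V]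
    (ι : V →L[ℝ] Lp ℝ 2 μ) (τ : V →L[ℝ] Lp ℝ 2 ν)
    (a : V →L[ℝ] V →L[ℝ] ℝ)
    (hsymm : ∀ u z : V, a u z = a z u)
    (hpos : ∀ u : V, 0 ≤ a u u)
    (hnorm : ∀ u : V, ‖u‖ ^ 2 = (∫ x, (ι u) x ^ 2 ∂μ) + a u u)
    (C : ℝ) (hC : 0 < C)
    (htrace : ∀ z : V, (∫ y, (τ z) y ^ 2 ∂ν) ≤ C ^ 2 * ‖z‖ ^ 2)
    (hτcpt : IsCompactOperator (⇑τ))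
    (β : ℝ → Set ℝ) (hβ : MaxMonotone β) (hβ0 : (0 : ℝ) ∈ β 0)
    (lam : ℝ) (hlam : 0 < lam)
    (βlam : ℝ → ℝ) (hYos : ∀ r : ℝ, βlam r ∈ β (r - lam * βlam r)) :
    (∀ u₁ u₂ : V,
      0 ≤ Bpair ι τ a lam βlam u₁ (u₁ - u₂) - Bpair ι τ a lam βlam u₂ (u₁ - u₂)) ∧
    ∀ F : V →L[ℝ] ℝ, ∃ u : V, ∀ z : V,
      (1 + lam) * (∫ x, (ι u) x * (ι z) x ∂μ) + 2 * a u z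
          + (∫ y, βlam ((τ u) y) * (τ z) y ∂ν) = F z := by
  have hy := aux_yosida β hβ lam βlam hYos
  have h0 : βlam 0 = 0 := by
    have := hβ.1 (hYos 0) hβ0
    have h : βlam 0 ^ 2 ≤ 0 := by
      by_contra h
      push Not at h
      nlinarith [mul_pos hlam h]
    exact pow_eq_zero_iff (two_ne_zero) |>.1 (le_antisymm h (sq_nonneg _))
  have hm : ∀ r s, 0 ≤ (βlam r - βlam s) * (r - s) := fun r s =>
    le_trans (by positivity) (hy r s)
  have hb : LipschitzWith (Real.toNNReal (1 / lam)) βlam := by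
    apply LipschitzWith.of_dist_le_mul
    intro r s
    rw [Real.coe_toNNReal _ (by positivity), Real.dist_eq, Real.dist_eq, div_mul_eq_mul_div,
      one_mul, le_div_iff₀ hlam]
    have h := (hy r s).trans ((le_abs_self _).trans (abs_mul _ _).le)
    rw [← sq_abs] at h
    rcases (abs_nonneg (βlam r - βlam s)).eq_or_lt with h1 | h1
    · rw [← h1, zero_mul]; positivity
    · refine le_of_mul_le_mul_left ?_ h1
      nlinarith
  have hcomp : ∀ u z : V, ∫ y, βlam ((τ u) y) * (τ z) y ∂ν
      = inner ℝ (hb.compLp h0 (τ u)) (τ z) := by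
    intro u z
    rw [aux_inner]
    apply integral_congr_ae
    filter_upwards [hb.coeFn_compLp h0 (τ u)] with y h
    simp only [h, Function.comp_apply]
  have hnorm' : ∀ u : V, ‖u‖ ^ 2 = inner ℝ (ι u) (ι u) + a u u := by
    intro u
    rw [hnorm, aux_inner]
    simp only [sq]
  constructor
  · intro u₁ u₂
    simp only [Bpair, hcomp, ← aux_inner]
    have h1 := aux_mono hb h0 hm (τ u₁) (τ u₂)
    have h2 := hpos (u₁ - u₂)
    have h3 := mul_nonneg hlam.le (real_inner_self_nonneg (x := ι (u₁ - u₂)))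
    rw [← map_sub τ, inner_sub_left] at h1
    rw [map_sub a, sub_apply] at h2
    nth_rewrite 1 [map_sub ι] at h3
    rw [inner_sub_left] at h3
    linarith
  · intro F
    let G : V → (V →L[ℝ] ℝ) := fun u => (1 + lam) • ((innerSL ℝ (ι u)).comp ι) + (2 : ℝ) • a u
      + (innerSL ℝ (hb.compLp h0 (τ u))).comp τ
    have hG : ∀ u z, G u z = (1 + lam) * inner ℝ (ι u) (ι z) + 2 * a u z
        + inner ℝ (hb.compLp h0 (τ u)) (τ z) := fun u z => rfl
    have hGd : ∀ u v z, (G u - G v) z = (1 + lam) * inner ℝ (ι (u - v)) (ι z) + 2 * a (u - v) z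
        + inner ℝ (hb.compLp h0 (τ u) - hb.compLp h0 (τ v)) (τ z) := by
      intro u v z
      rw [sub_apply, hG, hG, map_sub a, sub_apply, map_sub ι, inner_sub_left,
        inner_sub_left]
      ring
    let D := (InnerProductSpace.toDual ℝ V).symm
    obtain ⟨u, hu⟩ := aux_zarantonello (fun u => D (G u))
      ((1 + lam) * (‖ι‖ * ‖ι‖) + 2 * ‖a‖ + (1 / lam) * (‖τ‖ * ‖τ‖)) (by
        intro u v
        rw [← map_sub, InnerProductSpace.toDual_symm_apply, hGd, hnorm']
        have h1 := aux_mono hb h0 hm (τ u) (τ v)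
        rw [← map_sub τ] at h1
        have h2 := hpos (u - v)
        have h3 := mul_nonneg hlam.le (real_inner_self_nonneg (x := ι (u - v)))
        linarith) (by
        intro u v
        rw [← map_sub, LinearIsometryEquiv.norm_map]
        apply ContinuousLinearMap.opNorm_le_bound _ (by positivity)
        intro z
        rw [hGd]
        have hi : ∀ w, ‖ι w‖ ≤ ‖ι‖ * ‖w‖ := ι.le_opNorm
        have ht : ∀ w, ‖τ w‖ ≤ ‖τ‖ * ‖w‖ := τ.le_opNorm
        have h1 : ‖inner ℝ (ι (u - v)) (ι z)‖ ≤ (‖ι‖ * ‖u - v‖) * (‖ι‖ * ‖z‖) :=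
          (norm_inner_le_norm _ _).trans
            (mul_le_mul (hi _) (hi _) (norm_nonneg _) (by positivity))
        have h2 : ‖a (u - v) z‖ ≤ ‖a‖ * ‖u - v‖ * ‖z‖ := a.le_opNorm₂ _ _
        have h4 : ‖hb.compLp h0 (τ u) - hb.compLp h0 (τ v)‖ ≤ (1 / lam) * (‖τ‖ * ‖u - v‖) := by
          have h := hb.norm_compLp_sub_le h0 (τ u) (τ v)
          rw [Real.coe_toNNReal _ (by positivity), ← map_sub] at h
          exact h.trans (mul_le_mul_of_nonneg_left (ht _) (by positivity))
        have h3 : ‖inner ℝ (hb.compLp h0 (τ u) - hb.compLp h0 (τ v)) (τ z)‖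
            ≤ ((1 / lam) * (‖τ‖ * ‖u - v‖)) * (‖τ‖ * ‖z‖) :=
          (norm_inner_le_norm _ _).trans
            (mul_le_mul h4 (ht _) (norm_nonneg _) (by positivity))
        refine (norm_add₃_le).trans ?_
        rw [norm_mul, norm_mul, Real.norm_of_nonneg (by linarith : 0 ≤ 1 + lam),
          Real.norm_of_nonneg (by norm_num : (0 : ℝ) ≤ 2)]
        have h5 := mul_le_mul_of_nonneg_left h1 (by linarith : 0 ≤ 1 + lam)
        linarith) (D F)
    refine ⟨u, fun z => ?_⟩
    have hu' : G u = F := D.injective hu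
    rw [hcomp, ← aux_inner, ← hG, hu']

end
end

section
/- Fix λ, ε > 0 and let β_λ^ε be the truncation of β_λ at level 1/ε. Then for every F ∈ H¹(Ω)' there exists u_ε ∈ H¹(Ω) satisfying (1+λ)∫_Ω u_ε z dx + 2∫_Ω ∇u_ε·∇z dx + ∫_{Γ₁} β_λ^ε(u_ε)z ds = ⟨F,z⟩ for all z ∈ H¹(Ω); moreover every such solution obeys the ε-independent bound (1/2 + λ)‖u_ε‖²_{L²(Ω)} + (3/2)‖∇u_ε‖²_{L²(Ω)} ≤ ‖F‖²_{H¹(Ω)'}. -/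
open Set MeasureTheory
open scoped ENNReal

noncomputable section

/-- Zarantonello: a strongly monotone Lipschitz operator on a Hilbert space is surjective. -/
theorem zarantonello_aux {V : Type*} [NormedAddCommGroup V] [InnerProductSpace ℝ V]
    [CompleteSpace V] (S : V → V) (L : ℝ) (hL : 1 ≤ L)
    (hlip : ∀ u v, ‖S u - S v‖ ≤ L * ‖u - v‖)
    (hmon : ∀ u v, ‖u - v‖ ^ 2 ≤ inner ℝ (S u - S v) (u - v)) (f : V) : ∃ u, S u = f := by
  have hL2 : (0:ℝ) < L ^ 2 := by positivity
  set ρ : ℝ := 1 / L ^ 2 with hρ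
  have hρ0 : 0 < ρ := by positivity
  have hρ1 : ρ ≤ 1 := by
    rw [hρ, div_le_one hL2]; nlinarith
  have hρL : ρ * L ^ 2 = 1 := by rw [hρ]; field_simp
  set K : NNReal := ⟨Real.sqrt (1 - ρ), Real.sqrt_nonneg _⟩ with hK
  have hΦ : ContractingWith K (fun u => u - ρ • (S u - f)) := by
    refine ⟨?_, ?_⟩
    · rw [← NNReal.coe_lt_coe]
      change Real.sqrt (1 - ρ) < 1
      rw [Real.sqrt_lt' one_pos]; linarith
    · refine LipschitzWith.of_dist_le_mul fun u v => ?_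
      rw [dist_eq_norm, dist_eq_norm]
      change _ ≤ Real.sqrt (1 - ρ) * _
      have e : u - ρ • (S u - f) - (v - ρ • (S v - f)) = (u - v) - ρ • (S u - S v) := by
        module
      rw [e]
      refine (sq_le_sq₀ (norm_nonneg _) (by positivity)).mp ?_
      rw [mul_pow, Real.sq_sqrt (by linarith), norm_sub_sq_real, inner_smul_right, norm_smul,
        mul_pow, Real.norm_eq_abs, sq_abs, real_inner_comm]
      have h1 := hmon u v
      have h2 : ‖S u - S v‖ ^ 2 ≤ L ^ 2 * ‖u - v‖ ^ 2 := by
        rw [← mul_pow]; exact pow_le_pow_left₀ (norm_nonneg _) (hlip u v) 2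
      have h3 : ρ ^ 2 * ‖S u - S v‖ ^ 2 ≤ ρ * ‖u - v‖ ^ 2 := by
        calc ρ ^ 2 * ‖S u - S v‖ ^ 2 ≤ ρ ^ 2 * (L ^ 2 * ‖u - v‖ ^ 2) := by gcongr
          _ = ρ * (ρ * L ^ 2) * ‖u - v‖ ^ 2 := by ring
          _ = ρ * ‖u - v‖ ^ 2 := by rw [hρL, mul_one]
      have h4 := mul_le_mul_of_nonneg_left h1 hρ0.le
      linarith
  have hfix := hΦ.fixedPoint_isFixedPt
  refine ⟨ContractingWith.fixedPoint _ hΦ, ?_⟩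
  have := hfix.eq
  simp only [sub_eq_self, smul_eq_zero, hρ0.ne', false_or] at this
  exact sub_eq_zero.mp this

theorem yosida_aux (β : ℝ → Set ℝ) (hβ : MaxMonotone β) (hβ0 : (0 : ℝ) ∈ β 0)
    (lam ε : ℝ) (hlam : 0 < lam) (hε : 0 < ε)
    (βlam : ℝ → ℝ) (hYos : ∀ r : ℝ, βlam r ∈ β (r - lam * βlam r))
    (βlamε : ℝ → ℝ)
    (htrunc : ∀ r : ℝ, βlamε r = max (-(1/ε)) (min (βlam r) (1/ε))) :
    Monotone βlamε ∧ LipschitzWith (Real.toNNReal (1 / lam)) βlamε ∧ βlamε 0 = 0 := by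
  have key : ∀ r s, lam * (βlam r - βlam s) ^ 2 ≤ (βlam r - βlam s) * (r - s) := by
    intro r s
    have := hβ.1 (hYos r) (hYos s)
    nlinarith
  have hmono : Monotone βlam := by
    intro r s hrs
    by_contra! hlt
    have h := key r s
    have : (0:ℝ) < (βlam r - βlam s) ^ 2 := by
      have : 0 < βlam r - βlam s := by linarith
      positivity
    nlinarith
  have hlip : LipschitzWith (Real.toNNReal (1 / lam)) βlam := by
    refine LipschitzWith.of_dist_le_mul fun r s => ?_
    rw [Real.coe_toNNReal _ (by positivity), Real.dist_eq, Real.dist_eq]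
    have h := key r s
    have h2 : (βlam r - βlam s) * (r - s) ≤ |βlam r - βlam s| * |r - s| := by
      rw [← abs_mul]; exact le_abs_self _
    rw [← sq_abs] at h
    rcases (abs_nonneg (βlam r - βlam s)).eq_or_lt with h0 | h0
    · rw [← h0]; positivity
    · have h3 : lam * |βlam r - βlam s| ≤ |r - s| := by
        by_contra! h4
        nlinarith [mul_lt_mul_of_pos_left h4 h0]
      rw [one_div, ← div_eq_inv_mul, le_div_iff₀ hlam]; linarith
  have h0 : βlam 0 = 0 := by
    have h := hβ.1 (hYos 0) hβ0
    have h5 : lam * (βlam 0) ^ 2 ≤ 0 := by nlinarith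
    have : (βlam 0) ^ 2 ≤ 0 := by
      by_contra! h6
      nlinarith [mul_pos hlam h6]
    exact pow_eq_zero_iff (two_ne_zero) |>.mp (le_antisymm this (sq_nonneg _))
  have e : βlamε = fun r => max (-(1/ε)) (min (βlam r) (1/ε)) := funext htrunc
  have hε' : 0 < 1 / ε := by positivity
  refine ⟨?_, ?_, ?_⟩
  · rw [e]; intro r s hrs
    exact max_le_max le_rfl (min_le_min (hmono hrs) le_rfl)
  · rw [e]; exact (hlip.min_const _).const_max _
  · rw [htrunc, h0, min_eq_left hε'.le, max_eq_right (by linarith)]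

/-- Fix `λ, ε > 0` and let `β_λ^ε` be the truncation of the Yosida
approximation `β_λ` at level `1/ε`.  Then for every `F ∈ H¹(Ω)'` there exists
`u_ε ∈ H¹(Ω)` satisfying
`(1+λ)∫_Ω u_ε z + 2∫_Ω ∇u_ε·∇z + ∫_{Γ₁} β_λ^ε(u_ε) z ds = ⟨F,z⟩` for all `z ∈ H¹(Ω)`;
moreover every such solution obeys the `ε`-independent bound
`(1/2 + λ)‖u_ε‖²_{L²(Ω)} + (3/2)‖∇u_ε‖²_{L²(Ω)} ≤ ‖F‖²_{H¹(Ω)'}`.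

Abstract setting: `ι : V → L²(μ)` inclusion, `τ : V → L²(ν)` trace (compact, encoding the
compact embedding `H¹ ↪ H^{1-δ}` and trace continuity used in the Schauder fixed point
argument), `a` the Dirichlet form with `‖u‖² = ‖ιu‖²_{L²} + a(u,u)`. -/
theorem stmt_9
    {X Y : Type*} [MeasurableSpace X] [MeasurableSpace Y]
    (μ : Measure X) (ν : Measure Y) [IsFiniteMeasure μ] [IsFiniteMeasure ν]
    {V : Type*} [NormedAddCommGroup V] [InnerProductSpace ℝ V] [CompleteSpace V]
    (ι : V →L[ℝ] Lp ℝ 2 μ) (τ : V →L[ℝ] Lp ℝ 2 ν)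
    (a : V →L[ℝ] V →L[ℝ] ℝ)
    (hsymm : ∀ u z : V, a u z = a z u)
    (hpos : ∀ u : V, 0 ≤ a u u)
    (hnorm : ∀ u : V, ‖u‖ ^ 2 = (∫ x, (ι u) x ^ 2 ∂μ) + a u u)
    (C : ℝ) (hC : 0 < C)
    (htrace : ∀ z : V, (∫ y, (τ z) y ^ 2 ∂ν) ≤ C ^ 2 * ‖z‖ ^ 2)
    (hτcpt : IsCompactOperator (⇑τ))
    (β : ℝ → Set ℝ) (hβ : MaxMonotone β) (hβ0 : (0 : ℝ) ∈ β 0)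
    (lam ε : ℝ) (hlam : 0 < lam) (hε : 0 < ε)
    (βlam : ℝ → ℝ) (hYos : ∀ r : ℝ, βlam r ∈ β (r - lam * βlam r))
    (βlamε : ℝ → ℝ)
    (htrunc : ∀ r : ℝ, βlamε r = max (-(1/ε)) (min (βlam r) (1/ε)))
    (F : V →L[ℝ] ℝ) :
    (∃ u : V, ∀ z : V,
      (1 + lam) * (∫ x, (ι u) x * (ι z) x ∂μ) + 2 * a u z
          + (∫ y, βlamε ((τ u) y) * (τ z) y ∂ν) = F z) ∧
    (∀ u : V,
      (∀ z : V,
        (1 + lam) * (∫ x, (ι u) x * (ι z) x ∂μ) + 2 * a u z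
            + (∫ y, βlamε ((τ u) y) * (τ z) y ∂ν) = F z) →
      (1/2 + lam) * (∫ x, (ι u) x ^ 2 ∂μ) + (3/2) * a u u ≤ ‖F‖ ^ 2) := by
  classical
  obtain ⟨hmono, hlip, h0⟩ := yosida_aux β hβ hβ0 lam ε hlam hε βlam hYos βlamε htrunc
  have hsqι : ∀ u, (∫ x, (ι u) x ^ 2 ∂μ) = ‖ι u‖ ^ 2 := by
    intro u
    rw [← real_inner_self_eq_norm_sq, L2.inner_def]
    simp [pow_two]
  have hinι : ∀ u z, (∫ x, (ι u) x * (ι z) x ∂μ) = inner ℝ (ι u) (ι z) := by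
    intro u z
    rw [L2.inner_def]
    simp [mul_comm]
  set N : Lp ℝ 2 ν → Lp ℝ 2 ν := hlip.compLp h0 with hN
  have hNae : ∀ g : Lp ℝ 2 ν, N g =ᵐ[ν] βlamε ∘ g := fun g => hlip.coeFn_compLp h0 g
  have hinτ : ∀ u z, (∫ y, βlamε ((τ u) y) * (τ z) y ∂ν) = inner ℝ (N (τ u)) (τ z) := by
    intro u z
    rw [L2.inner_def]
    apply integral_congr_ae
    filter_upwards [hNae (τ u)] with y hy
    simp [hy, mul_comm]
  have hNmon : ∀ g h : Lp ℝ 2 ν, 0 ≤ inner ℝ (N g - N h) (g - h) := by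
    intro g h
    rw [L2.inner_def]
    apply integral_nonneg_of_ae
    filter_upwards [hNae g, hNae h, Lp.coeFn_sub g h, Lp.coeFn_sub (N g) (N h)] with y h1 h2 h3 h4
    simp only [h3, h4, Pi.sub_apply, h1, h2, Function.comp, Pi.zero_apply]
    change 0 ≤ (g y - h y) * (βlamε (g y) - βlamε (h y))
    rcases le_total (g y) (h y) with hh | hh
    · exact mul_nonneg_of_nonpos_of_nonpos (by linarith) (by linarith [hmono hh])
    · exact mul_nonneg (by linarith) (by linarith [hmono hh])
  have hNlip : ∀ g h : Lp ℝ 2 ν, ‖N g - N h‖ ≤ (1 / lam) * ‖g - h‖ := by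
    intro g h
    have := (hlip.lipschitzWith_compLp h0 (p := 2) (μ := ν)).dist_le_mul g h
    rwa [dist_eq_norm, dist_eq_norm, Real.coe_toNNReal _ (by positivity)] at this
  have hN0 : N 0 = 0 := hlip.compLp_zero h0
  have hnorm' : ∀ u, ‖u‖ ^ 2 = ‖ι u‖ ^ 2 + a u u := fun u => by rw [hnorm u, hsqι]
  have hpol : ∀ u z, a u z = inner ℝ u z - inner ℝ (ι u) (ι z) := by
    intro u z
    have h1 := hnorm' (u + z)
    have h2 := hnorm' u
    have h3 := hnorm' z
    rw [map_add, norm_add_sq_real, norm_add_sq_real] at h1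
    simp only [map_add, ContinuousLinearMap.add_apply] at h1
    rw [hsymm z u] at h1
    linarith
  constructor
  · set S : V → V := fun u => (2:ℝ) • u + (lam - 1) • (ContinuousLinearMap.adjoint ι (ι u))
      + ContinuousLinearMap.adjoint τ (N (τ u)) with hS
    have hSin : ∀ u z, inner ℝ (S u) z = 2 * inner ℝ u z + (lam - 1) * inner ℝ (ι u) (ι z)
        + inner ℝ (N (τ u)) (τ z) := by
      intro u z
      simp only [hS, inner_add_left, real_inner_smul_left, ContinuousLinearMap.adjoint_inner_left]
    have hmon : ∀ u v, ‖u - v‖ ^ 2 ≤ inner ℝ (S u - S v) (u - v) := by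
      intro u v
      have e : inner ℝ (S u - S v) (u - v) = 2 * ‖u - v‖ ^ 2 + (lam - 1) * ‖ι (u - v)‖ ^ 2
          + inner ℝ (N (τ u) - N (τ v)) (τ u - τ v) := by
        rw [inner_sub_left, hSin, hSin, ← real_inner_self_eq_norm_sq,
          ← real_inner_self_eq_norm_sq, inner_sub_left (N (τ u)), inner_sub_left u v,
          map_sub, inner_sub_left (ι u) (ι v), map_sub]
        ring
      have h1 := hNmon (τ u) (τ v)
      have h2 := hnorm' (u - v)
      have h3 := hpos (u - v)
      have h4 : 0 ≤ lam * ‖ι (u - v)‖ ^ 2 := by positivity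
      rw [e]; linarith
    set A := ContinuousLinearMap.adjoint ι
    set B := ContinuousLinearMap.adjoint τ
    set L : ℝ := 2 + |lam - 1| * (‖A‖ * ‖ι‖) + ‖B‖ * ((1 / lam) * ‖τ‖) with hL
    have hlipS : ∀ u v, ‖S u - S v‖ ≤ L * ‖u - v‖ := by
      intro u v
      have e : S u - S v = (2:ℝ) • (u - v) + (lam - 1) • (A (ι (u - v)))
          + B (N (τ u) - N (τ v)) := by
        simp only [hS, map_sub]; module
      have h1 : ‖A (ι (u - v))‖ ≤ ‖A‖ * (‖ι‖ * ‖u - v‖) :=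
        A.le_opNorm_of_le (ι.le_opNorm _)
      have h2 : ‖B (N (τ u) - N (τ v))‖ ≤ ‖B‖ * ((1 / lam) * (‖τ‖ * ‖u - v‖)) := by
        apply B.le_opNorm_of_le
        refine (hNlip _ _).trans ?_
        rw [← map_sub]
        have := τ.le_opNorm (u - v)
        gcongr
      rw [e]
      calc _ ≤ ‖(2:ℝ) • (u - v)‖ + ‖(lam - 1) • (A (ι (u - v)))‖ + ‖B (N (τ u) - N (τ v))‖ :=
            norm_add₃_le
        _ ≤ 2 * ‖u - v‖ + |lam - 1| * (‖A‖ * (‖ι‖ * ‖u - v‖))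
            + ‖B‖ * ((1 / lam) * (‖τ‖ * ‖u - v‖)) := by
          rw [norm_smul, norm_smul, Real.norm_eq_abs, Real.norm_eq_abs, abs_two]
          gcongr
        _ = _ := by rw [hL]; ring
    have hL1 : 1 ≤ L := by
      have : 0 ≤ |lam - 1| * (‖A‖ * ‖ι‖) + ‖B‖ * ((1 / lam) * ‖τ‖) := by positivity
      linarith
    obtain ⟨u, hu⟩ := zarantonello_aux S L hL1 hlipS hmon ((InnerProductSpace.toDual ℝ V).symm F)
    refine ⟨u, fun z => ?_⟩
    have := hSin u z
    rw [hu, InnerProductSpace.toDual_symm_apply] at this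
    rw [hinι, hinτ, hpol, this]
    ring
  · intro u hu
    have h := hu u
    rw [hinι, hinτ, real_inner_self_eq_norm_sq] at h
    rw [hsqι]
    have h1 := hNmon (τ u) 0
    rw [hN0, sub_zero, sub_zero] at h1
    have h2 : F u ≤ ‖F‖ * ‖u‖ := (le_abs_self _).trans (F.le_opNorm u)
    have h3 := hnorm' u
    nlinarith [sq_nonneg (‖F‖ - ‖u‖), sq_nonneg ‖F‖]


end
end

section
/- Fix λ, ε > 0 and F ∈ H¹(Ω)'. For ū ∈ H^{1−δ}(Ω) (δ ∈ (0,1/2)), let Ψ_ε(ū) = u_ε be the unique Lax–Milgram solution of (1+λ)∫_Ω u_ε z dx + 2∫_Ω ∇u_ε·∇z dx = −∫_{Γ₁} β_λ^ε(ū)z ds + ⟨F,z⟩ for all z ∈ H¹(Ω). Then Ψ_ε is continuous from H^{1−δ}(Ω) to H^{1−δ}(Ω); more precisely, for ū₁, ū₂ with solutions u₁, u₂, one has (1/2 + λ)‖u₁ − u₂‖²_{L²(Ω)} + (3/2)‖∇(u₁ − u₂)‖²_{L²(Ω)} ≤ (C²/(2λ²))‖ū₁ − ū₂‖²_{L²(Γ₁)},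 where C is the trace constant of H¹(Ω) into L²(Γ₁). -/
open Set MeasureTheory
open scoped ENNReal

noncomputable section

theorem aux_lip (β : ℝ → Set ℝ) (hβ : MaxMonotone β) (lam ε : ℝ) (hlam : 0 < lam)
    (βlam : ℝ → ℝ) (hYos : ∀ r : ℝ, βlam r ∈ β (r - lam * βlam r))
    (βlamε : ℝ → ℝ)
    (htrunc : ∀ r : ℝ, βlamε r = max (-(1/ε)) (min (βlam r) (1/ε))) (r s : ℝ) :
    lam * |βlamε r - βlamε s| ≤ |r - s| := by
  have h1 : |βlamε r - βlamε s| ≤ |βlam r - βlam s| := by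
    rw [htrunc, htrunc]
    refine (abs_max_sub_max_le_max _ _ _ _).trans ?_
    rw [sub_self, abs_zero]
    refine max_le (abs_nonneg _) ?_
    refine (abs_min_sub_min_le_max _ _ _ _).trans ?_
    rw [sub_self, abs_zero]
    exact max_le le_rfl (abs_nonneg _)
  have h2 : lam * |βlam r - βlam s| ≤ |r - s| := by
    have h := hβ.1 (hYos r) (hYos s)
    have h3 : lam * (|βlam r - βlam s| * |βlam r - βlam s|) ≤ |βlam r - βlam s| * |r - s| := by
      rw [abs_mul_abs_self, ← abs_mul]
      refine le_trans ?_ (le_abs_self _)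
      linarith
    rcases (abs_nonneg (βlam r - βlam s)).eq_or_lt with h0 | h0
    · rw [← h0, mul_zero]; exact abs_nonneg _
    · refine le_of_mul_le_mul_left ?_ h0
      linarith
  exact (mul_le_mul_of_nonneg_left h1 hlam.le).trans h2

theorem aux_sq {Y : Type*} [MeasurableSpace Y] (ν : Measure Y) (f : Lp ℝ 2 ν) :
    ∫ y, f y ^ 2 ∂ν = ‖f‖ ^ 2 := by
  rw [← real_inner_self_eq_norm_sq, L2.inner_def]
  refine integral_congr_ae (Filter.Eventually.of_forall fun y => ?_)
  simp [pow_two]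

theorem aux_sub {Y : Type*} [MeasurableSpace Y] (ν : Measure Y) (f g : Lp ℝ 2 ν) :
    ∫ y, (f y - g y) ^ 2 ∂ν = ‖f - g‖ ^ 2 := by
  rw [← aux_sq]
  refine integral_congr_ae ?_
  filter_upwards [Lp.coeFn_sub f g] with y hy
  rw [hy]; rfl

theorem aux_mul {Y : Type*} [MeasurableSpace Y] (ν : Measure Y) (f g : Lp ℝ 2 ν) :
    ∫ y, f y * g y ∂ν = inner ℝ f g := by
  rw [L2.inner_def]
  refine integral_congr_ae (Filter.Eventually.of_forall fun y => ?_)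
  simp [mul_comm]

theorem aux_bd {Y : Type*} [MeasurableSpace Y] (ν : Measure Y) [IsFiniteMeasure ν]
    (b : ℝ → ℝ) (lam C : ℝ) (hlam : 0 < lam) (hC : 0 < C)
    (hb : ∀ r s, lam * |b r - b s| ≤ |r - s|) (f g t : Lp ℝ 2 ν) :
    -(∫ y, b (f y) * t y ∂ν) + (∫ y, b (g y) * t y ∂ν)
      ≤ C ^ 2 / (2 * lam ^ 2) * ‖f - g‖ ^ 2 + 1 / (2 * C ^ 2) * ‖t‖ ^ 2 := by
  have hlip : LipschitzWith (Real.toNNReal (1 / lam)) b := by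
    refine LipschitzWith.of_dist_le_mul fun r s => ?_
    rw [Real.dist_eq, Real.dist_eq, Real.coe_toNNReal _ (by positivity)]
    have := hb r s
    rw [one_div, ← div_eq_inv_mul, le_div_iff₀ hlam]
    linarith
  have hmem : ∀ h : Lp ℝ 2 ν, MemLp (fun y => b (h y)) 2 ν := by
    intro h
    have h1 : MemLp (fun y => lam⁻¹ * |h y| + |b 0|) 2 ν :=
      ((Lp.memLp h).abs.const_mul lam⁻¹).add (memLp_const _)
    refine h1.mono (hlip.continuous.comp_aestronglyMeasurable (Lp.aestronglyMeasurable h)) ?_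
    refine Filter.Eventually.of_forall fun y => ?_
    have h2 := hb (h y) 0
    rw [sub_zero] at h2
    have h3 : |b (h y) - b 0| ≤ lam⁻¹ * |h y| := by
      rw [← div_eq_inv_mul, le_div_iff₀ hlam]; linarith
    have h4 : |b (h y)| ≤ |b (h y) - b 0| + |b 0| := by
      simpa using abs_add_le (b (h y) - b 0) (b 0)
    rw [Real.norm_eq_abs, Real.norm_eq_abs]
    exact (h4.trans (by linarith)).trans (le_abs_self _)
  have hint : ∀ h : Lp ℝ 2 ν, Integrable (fun y => b (h y) * t y) ν := fun h =>
    (hmem h).integrable_mul (Lp.memLp t)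
  have i1 : Integrable (fun y => (f y - g y) ^ 2) ν :=
    ((Lp.memLp f).sub (Lp.memLp g)).integrable_sq
  have i2 : Integrable (fun y => (t y) ^ 2) ν := (Lp.memLp t).integrable_sq
  have i3 : Integrable (fun y => -(b (f y) * t y)) ν := (hint f).neg
  rw [← aux_sub, ← aux_sq, ← integral_const_mul, ← integral_const_mul,
    ← integral_add (i1.const_mul _) (i2.const_mul _), ← integral_neg,
    ← integral_add i3 (hint g)]
  refine integral_mono (i3.add (hint g)) ((i1.const_mul _).add (i2.const_mul _)) ?_
  intro y
  have h1 := hb (f y) (g y)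
  set d := b (f y) - b (g y) with hd
  have h2 : d ^ 2 ≤ (f y - g y) ^ 2 / lam ^ 2 := by
    rw [le_div_iff₀ (by positivity)]
    have := pow_le_pow_left₀ (by positivity) h1 2
    rw [mul_pow, sq_abs, sq_abs] at this
    linarith
  have h3 : 0 ≤ (C * d + t y / C) ^ 2 := sq_nonneg _
  have h4 : (C * d + t y / C) ^ 2 = C ^ 2 * d ^ 2 + 2 * (d * t y) + t y ^ 2 / C ^ 2 := by
    field_simp; ring
  have h5 := mul_le_mul_of_nonneg_left h2 (sq_nonneg C)
  have h6 : C ^ 2 / (2 * lam ^ 2) * (f y - g y) ^ 2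
    = C ^ 2 * ((f y - g y) ^ 2 / lam ^ 2) / 2 := by field_simp
  have h7 : 1 / (2 * C ^ 2) * t y ^ 2 = t y ^ 2 / C ^ 2 / 2 := by field_simp
  change -(b (f y) * t y) + b (g y) * t y
    ≤ C ^ 2 / (2 * lam ^ 2) * (f y - g y) ^ 2 + 1 / (2 * C ^ 2) * t y ^ 2
  rw [h6, h7]
  have h8 : -(b (f y) * t y) + b (g y) * t y = -(d * t y) := by rw [hd]; ring
  rw [h8]
  linarith

/-- Fix `λ, ε > 0` and `F ∈ H¹(Ω)'`.  For `ū ∈ H^{1−δ}(Ω)` (`δ ∈ (0,1/2)`)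
let `Ψ_ε(ū) = u_ε` be the unique Lax–Milgram solution of
`(1+λ)∫_Ω u_ε z + 2∫_Ω ∇u_ε·∇z = −∫_{Γ₁} β_λ^ε(ū) z ds + ⟨F,z⟩`  (for all `z ∈ H¹(Ω)`).
Then `Ψ_ε : H^{1−δ}(Ω) → H^{1−δ}(Ω)` is continuous; more precisely, for `ū₁, ū₂` with
solutions `u₁, u₂` one has
`(1/2 + λ)‖u₁ − u₂‖²_{L²(Ω)} + (3/2)‖∇(u₁ − u₂)‖²_{L²(Ω)} ≤ (C²/(2λ²))‖ū₁ − ū₂‖²_{L²(Γ₁)}`,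
`C` being the trace constant of `H¹(Ω)` into `L²(Γ₁)`.

Abstract setting: `V = H¹(Ω)`, `W = H^{1−δ}(Ω)` with embedding `j : V → W`; traces are taken
through the continuous trace `τW : W → L²(Γ₁)` of `H^{1−δ}(Ω)`, and `a` is the Dirichlet
form with `‖u‖²_{H¹} = ‖ιu‖²_{L²} + a(u,u)`;  `β_λ^ε` is the truncation at level `1/ε` of
the Yosida approximation `β_λ` of `β` (hence `(1/λ)`-Lipschitz with `β_λ^ε(0) = 0`). -/
theorem stmt_10
    {X Y : Type*} [MeasurableSpace X] [MeasurableSpace Y]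
    (μ : Measure X) (ν : Measure Y) [IsFiniteMeasure μ] [IsFiniteMeasure ν]
    {V : Type*} [NormedAddCommGroup V] [InnerProductSpace ℝ V] [CompleteSpace V]
    {W : Type*} [NormedAddCommGroup W] [NormedSpace ℝ W]
    (ι : V →L[ℝ] Lp ℝ 2 μ) (j : V →L[ℝ] W) (τW : W →L[ℝ] Lp ℝ 2 ν)
    (a : V →L[ℝ] V →L[ℝ] ℝ)
    (hsymm : ∀ u z : V, a u z = a z u)
    (hpos : ∀ u : V, 0 ≤ a u u)
    (hnorm : ∀ u : V, ‖u‖ ^ 2 = (∫ x, (ι u) x ^ 2 ∂μ) + a u u)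
    (C : ℝ) (hC : 0 < C)
    (htrace : ∀ z : V, (∫ y, (τW (j z)) y ^ 2 ∂ν) ≤ C ^ 2 * ‖z‖ ^ 2)
    (β : ℝ → Set ℝ) (hβ : MaxMonotone β) (hβ0 : (0 : ℝ) ∈ β 0)
    (lam ε : ℝ) (hlam : 0 < lam) (hε : 0 < ε)
    (βlam : ℝ → ℝ) (hYos : ∀ r : ℝ, βlam r ∈ β (r - lam * βlam r))
    (βlamε : ℝ → ℝ)
    (htrunc : ∀ r : ℝ, βlamε r = max (-(1/ε)) (min (βlam r) (1/ε)))
    (F : V →L[ℝ] ℝ)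
    (Ψ : W → V)
    (hΨ : ∀ ub : W, ∀ z : V,
      (1 + lam) * (∫ x, (ι (Ψ ub)) x * (ι z) x ∂μ) + 2 * a (Ψ ub) z
        = -(∫ y, βlamε ((τW ub) y) * (τW (j z)) y ∂ν) + F z) :
    Continuous (fun ub : W => j (Ψ ub)) ∧
    ∀ ub₁ ub₂ : W,
      (1/2 + lam) * (∫ x, ((ι (Ψ ub₁)) x - (ι (Ψ ub₂)) x) ^ 2 ∂μ)
          + (3/2) * a (Ψ ub₁ - Ψ ub₂) (Ψ ub₁ - Ψ ub₂)
        ≤ C ^ 2 / (2 * lam ^ 2) * (∫ y, ((τW ub₁) y - (τW ub₂) y) ^ 2 ∂ν) := by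
  have hlip := aux_lip β hβ lam ε hlam βlam hYos βlamε htrunc
  have key : ∀ ub₁ ub₂ : W,
      (1/2 + lam) * ‖ι (Ψ ub₁ - Ψ ub₂)‖ ^ 2 + (3/2) * a (Ψ ub₁ - Ψ ub₂) (Ψ ub₁ - Ψ ub₂)
        ≤ C ^ 2 / (2 * lam ^ 2) * ‖τW ub₁ - τW ub₂‖ ^ 2 := by
    intro ub₁ ub₂
    have e1 := hΨ ub₁ (Ψ ub₁ - Ψ ub₂)
    have e2 := hΨ ub₂ (Ψ ub₁ - Ψ ub₂)
    set w := Ψ ub₁ - Ψ ub₂ with hw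
    rw [aux_mul] at e1 e2
    have e3 : (inner ℝ (ι (Ψ ub₁)) (ι w) : ℝ) - inner ℝ (ι (Ψ ub₂)) (ι w) = ‖ι w‖ ^ 2 := by
      rw [← inner_sub_left, ← map_sub, ← hw, real_inner_self_eq_norm_sq]
    have e4 : a (Ψ ub₁) w - a (Ψ ub₂) w = a w w := by
      rw [← ContinuousLinearMap.sub_apply, ← map_sub, ← hw]
    have hb := aux_bd ν βlamε lam C hlam hC hlip (τW ub₁) (τW ub₂) (τW (j w))
    have ht := htrace w
    have hn := hnorm w
    rw [aux_sq] at ht hn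
    have h7 : 1 / (2 * C ^ 2) * ‖τW (j w)‖ ^ 2 ≤ ‖w‖ ^ 2 / 2 := by
      have := mul_le_mul_of_nonneg_left ht (show 0 ≤ 1 / (2 * C ^ 2) by positivity)
      refine this.trans (le_of_eq ?_)
      field_simp
    have e5 : (1 + lam) * ‖ι w‖ ^ 2 + 2 * a w w
        = -(∫ y, βlamε ((τW ub₁) y) * (τW (j w)) y ∂ν)
          + ∫ y, βlamε ((τW ub₂) y) * (τW (j w)) y ∂ν := by
      rw [← e3, ← e4]; linarith
    linarith
  constructor
  · refine j.continuous.comp ?_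
    have hL : LipschitzWith (Real.toNNReal (C / lam * ‖τW‖)) Ψ := by
      refine LipschitzWith.of_dist_le_mul fun u v => ?_
      rw [dist_eq_norm, dist_eq_norm, Real.coe_toNNReal _ (by positivity)]
      have h1 := key u v
      have hn := hnorm (Ψ u - Ψ v)
      rw [aux_sq] at hn
      have hp := hpos (Ψ u - Ψ v)
      have h2 : ‖Ψ u - Ψ v‖ ^ 2 ≤ (C / lam * ‖τW u - τW v‖) ^ 2 := by
        have h3 : C ^ 2 / (2 * lam ^ 2) * ‖τW u - τW v‖ ^ 2
            = (C / lam * ‖τW u - τW v‖) ^ 2 / 2 := by field_simp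
        have h4 : 0 ≤ lam * ‖ι (Ψ u - Ψ v)‖ ^ 2 := by positivity
        linarith
      have h5 := (pow_le_pow_iff_left₀ (norm_nonneg _) (by positivity) two_ne_zero).1 h2
      refine h5.trans ?_
      rw [mul_assoc, ← map_sub]
      exact mul_le_mul_of_nonneg_left (τW.le_opNorm _) (by positivity)
    exact hL.continuous
  · intro ub₁ ub₂
    rw [aux_sub, aux_sub, ← map_sub ι]
    exact key ub₁ ub₂

end
end
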